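/- Deletion lemma for the left key: let T = C_1C_2 be a non-rectangular two-column KN skew tableau on which the symplectic jeu de taquin moves one cell from the first column to the second, and let β be the entry to the left of the puncture in rC_1 immediately before the horizontal slide. Then, writing C_1' for the first column after the slide, ℓC_1' loses exactly one entry compared with ℓC_1, namely the largest entry of ℓC_1 in a row not below the row containing β that is greater than the entry directly Northeast of it (i.e., the entry of rC_1 one row above), or the top entry of ℓC_1 if no such entry exists. -/

import Mathlib

/-- The alphabet `[±n] = {1 < 2 < ⋯ < n < n̄ < ⋯ < 1̄}` is encoded as `{1, …, 2n} ⊆ ℕ`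
with the usual order, the barred letter `ī` being encoded as `2n+1-i`. -/
def bar (n x : ℕ) : ℕ := 2 * n + 1 - x

/-- A column over `[±n]`: a strictly increasing list with entries in `{1, …, 2n}`. -/
def IsColumn (n : ℕ) (C : List ℕ) : Prop :=
  C.Chain' (· < ·) ∧ ∀ x ∈ C, 1 ≤ x ∧ x ≤ 2 * n

/-- The one column condition (1CC): for every unbarred `i` with both `i` and `ī` in `C`,
the number of entries `x` with `x ≤ i` or `x ≥ ī` is at most `i`. -/
def OCC (n : ℕ) (C : List ℕ) : Prop :=
  ∀ i, 1 ≤ i → i ≤ n → i ∈ C → bar n i ∈ C →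
    C.countP (fun x => decide (x ≤ i ∨ bar n i ≤ x)) ≤ i

/-- The set `I` of unbarred letters `z` such that both `z` and `z̄` occur in `C`,
listed in decreasing order `z₁ > z₂ > ⋯ > z_r`. -/
def Ilist (n : ℕ) (C : List ℕ) : List ℕ :=
  ((List.range (n + 1)).filter (fun z => decide (1 ≤ z ∧ z ∈ C ∧ bar n z ∈ C))).reverse

/-- The greatest unbarred letter `t < bound` with `t ∉ C` and `t̄ ∉ C`, if any. -/
def pickBelow (n : ℕ) (C : List ℕ) (bound : ℕ) : Option ℕ :=
  ((List.range bound).filter (fun t => decide (1 ≤ t ∧ t ≤ n ∧ t ∉ C ∧ bar n t ∉ C))).max?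

/-- The greedy construction of the set `J = {t₁ > ⋯ > t_r}` of Definition of splitting:
`t₁` is the greatest letter `< z₁` with `t₁, t̄₁ ∉ C` and `tᵢ` is the greatest letter
`< min (tᵢ₋₁, zᵢ)` with `tᵢ, t̄ᵢ ∉ C`; returns `none` if at some stage no letter exists. -/
def splitJ (n : ℕ) (C : List ℕ) : List ℕ → ℕ → Option (List ℕ)
  | [], _ => some []
  | z :: zs, bound =>
    match pickBelow n C (min bound z) with
    | none => none
    | some t => (splitJ n C zs t).map (t :: ·)

def JlistOpt (n : ℕ) (C : List ℕ) : Option (List ℕ) := splitJ n C (Ilist n C) (n + 1)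

/-- `C` can be split: the set `J` of the splitting definition exists. -/
def CanSplit (n : ℕ) (C : List ℕ) : Prop := (JlistOpt n C).isSome = true

/-- The set `J = {t₁ > ⋯ > t_r}` (empty if `C` cannot be split). -/
def Jlist (n : ℕ) (C : List ℕ) : List ℕ := (JlistOpt n C).getD []

def sortCol (L : List ℕ) : List ℕ := L.mergeSort (· ≤ ·)

/-- The right column `rC`: replace each barred `z̄ᵢ` (for `zᵢ ∈ I`) by `t̄ᵢ` and reorder. -/
def rCol (n : ℕ) (C : List ℕ) : List ℕ :=
  sortCol ((C.filter (fun x => decide (x ∉ (Ilist n C).map (bar n)))) ++ (Jlist n C).map (bar n))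

/-- The left column `ℓC`: replace each unbarred `zᵢ ∈ I` by `tᵢ` and reorder. -/
def lCol (n : ℕ) (C : List ℕ) : List ℕ :=
  sortCol ((C.filter (fun x => decide (x ∉ Ilist n C))) ++ Jlist n C)

/-- `Φ(C)`: the column of the same size whose unbarred entries are taken from `ℓC`
and whose barred entries are taken from `rC`. -/
def PhiCol (n : ℕ) (C : List ℕ) : List ℕ :=
  sortCol ((lCol n C).filter (fun x => decide (x ≤ n)) ++
    (rCol n C).filter (fun x => decide (n < x)))

/-- `p` is the row of the first horizontal slide of the (reverse) symplectic jeu de taquin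
moving a cell from column 1 to column 2 of the straight two-column tableau `C1 C2`:
the puncture enters at row `|C2|+1` of column 2 and slides up (rows are 1-indexed)
while the entry of `ℓC2` just above it exceeds the entry of `rC1` to its left. -/
def FirstHSlideRow (n : ℕ) (C1 C2 : List ℕ) (p : ℕ) : Prop :=
  1 ≤ p ∧ p ≤ C2.length + 1 ∧
    (∀ k, p < k → k ≤ C2.length + 1 →
      (rCol n C1).getD (k - 1) 0 < (lCol n C2).getD (k - 2) 0) ∧
    (p = 1 ∨ (lCol n C2).getD (p - 2) 0 ≤ (rCol n C1).getD (p - 1) 0)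

open Classical in
/-- The inverse of the bijection `Φ` from admissible to coadmissible columns
(returns `D` itself if `D` is not of the form `Φ(C)`). -/
noncomputable def PhiInvF (n : ℕ) (D : List ℕ) : List ℕ :=
  if h : ∃ C, IsColumn n C ∧ OCC n C ∧ PhiCol n C = D then h.choose else D


def cge (S : Finset ℕ) (y : ℕ) : ℕ := (S.filter (fun x => y ≤ x)).card
def clt (S : Finset ℕ) (y : ℕ) : ℕ := (S.filter (fun x => x < y)).card

theorem cge_succ (S : Finset ℕ) (y : ℕ) :
    cge S y = cge S (y+1) + if y ∈ S then 1 else 0 := by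
  unfold cge
  split_ifs with h
  · rw [show S.filter (fun x => y ≤ x) = insert y (S.filter (fun x => y + 1 ≤ x)) by
      ext x; simp only [Finset.mem_filter, Finset.mem_insert]
      constructor
      · rintro ⟨h1, h2⟩
        by_cases h3 : x = y
        · exact Or.inl h3
        · exact Or.inr ⟨h1, by omega⟩
      · rintro (rfl | ⟨h1, h2⟩)
        · exact ⟨h, le_refl _⟩
        · exact ⟨h1, by omega⟩]
    rw [Finset.card_insert_of_notMem (by simp)]
  · congr 1
    ext x; simp only [Finset.mem_filter]
    constructor
    · rintro ⟨h1, h2⟩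
      refine ⟨h1, ?_⟩
      rcases Nat.lt_or_ge y x with h3 | h3
      · exact h3
      · exact absurd ((le_antisymm h2 h3) ▸ h1) h
    · rintro ⟨h1, h2⟩
      exact ⟨h1, by omega⟩

theorem clt_add_cge (S : Finset ℕ) (y : ℕ) : clt S y + cge S y = S.card := by
  unfold clt cge
  rw [← Finset.card_filter_add_card_filter_not (s := S) (fun x => x < y)]
  simp only [not_lt]

theorem clt_succ (S : Finset ℕ) (y : ℕ) :
    clt S (y+1) = clt S y + if y ∈ S then 1 else 0 := by
  have h1 := clt_add_cge S y
  have h2 := clt_add_cge S (y+1)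
  have h3 := cge_succ S y
  omega

theorem cge_zero (S : Finset ℕ) : cge S 0 = S.card := by simp [cge]
theorem clt_zero (S : Finset ℕ) : clt S 0 = 0 := by simp [clt]
theorem cge_top {n : ℕ} {S : Finset ℕ} (h : ∀ x ∈ S, x ≤ n) : cge S (n+1) = 0 := by
  simp only [cge, Finset.card_eq_zero, Finset.filter_eq_empty_iff]
  intro x hx; have := h x hx; omega
theorem clt_mono (S : Finset ℕ) {a b : ℕ} (h : a ≤ b) : clt S a ≤ clt S b :=
  Finset.card_le_card (fun x => by simp only [Finset.mem_filter]; rintro ⟨h1, h2⟩; exact ⟨h1, by omega⟩)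
theorem clt_sub {S T : Finset ℕ} (h : S ⊆ T) (a : ℕ) : clt S a ≤ clt T a :=
  Finset.card_le_card (Finset.filter_subset_filter _ h)

theorem cge_insert {S : Finset ℕ} {a : ℕ} (h : a ∉ S) (y : ℕ) :
    cge (insert a S) y = cge S y + if y ≤ a then 1 else 0 := by
  unfold cge
  rw [Finset.filter_insert]
  split_ifs with h1
  · rw [Finset.card_insert_of_notMem (by simp [h])]
  · rfl

theorem cge_erase {S : Finset ℕ} {a : ℕ} (h : a ∈ S) (y : ℕ) :
    cge S y = cge (S.erase a) y + if y ≤ a then 1 else 0 := by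
  rw [← cge_insert (Finset.notMem_erase a S), Finset.insert_erase h]

def enc (n : ℕ) (A B : Finset ℕ) : Finset ℕ :=
  (Finset.Icc 1 (2*n)).filter (fun y => (y ≤ n ∧ y ∈ A) ∨ (n < y ∧ bar n y ∈ B))

theorem mem_enc {n : ℕ} {A B : Finset ℕ} {y : ℕ} : y ∈ enc n A B ↔
    (1 ≤ y ∧ y ≤ n ∧ y ∈ A) ∨ (n < y ∧ y ≤ 2 * n ∧ bar n y ∈ B) := by
  simp only [enc, Finset.mem_filter, Finset.mem_Icc]
  constructor
  · rintro ⟨⟨h1, h2⟩, ⟨h3, h4⟩ | ⟨h3, h4⟩⟩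
    · exact Or.inl ⟨h1, h3, h4⟩
    · exact Or.inr ⟨h3, h2, h4⟩
  · rintro (⟨h1, h3, h4⟩ | ⟨h3, h2, h4⟩)
    · exact ⟨⟨h1, by omega⟩, Or.inl ⟨h3, h4⟩⟩
    · exact ⟨⟨by omega, h2⟩, Or.inr ⟨h3, h4⟩⟩

theorem mem_enc_lo {n : ℕ} {A B : Finset ℕ} {y : ℕ} (h1 : 1 ≤ y) (h2 : y ≤ n) :
    y ∈ enc n A B ↔ y ∈ A := by
  rw [mem_enc]; constructor
  · rintro (⟨_, _, h⟩ | ⟨h, _⟩)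
    · exact h
    · omega
  · intro h; exact Or.inl ⟨h1, h2, h⟩

theorem bar_bar {n y : ℕ} (h : y ≤ 2 * n + 1) : bar n (bar n y) = y := by unfold bar; omega

theorem mem_enc_hi {n : ℕ} {A B : Finset ℕ} {y : ℕ} (h1 : 1 ≤ y) (h2 : y ≤ n) :
    bar n y ∈ enc n A B ↔ y ∈ B := by
  rw [mem_enc, bar_bar (by omega)]; unfold bar; constructor
  · rintro (⟨_, h, _⟩ | ⟨_, _, h⟩)
    · omega
    · exact h
  · intro h; exact Or.inr ⟨by omega, by omega, h⟩

theorem enc_ext {n : ℕ} {T A B : Finset ℕ} (hT : ∀ x ∈ T, 1 ≤ x ∧ x ≤ 2 * n)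
    (h1 : ∀ y, 1 ≤ y → y ≤ n → (y ∈ T ↔ y ∈ A))
    (h2 : ∀ y, 1 ≤ y → y ≤ n → (bar n y ∈ T ↔ y ∈ B)) : T = enc n A B := by
  ext x
  by_cases hx : 1 ≤ x ∧ x ≤ 2 * n
  · by_cases hn : x ≤ n
    · rw [h1 x hx.1 hn, mem_enc_lo hx.1 hn]
    · have h3 := h2 (bar n x) (by unfold bar; omega) (by unfold bar; omega)
      have h4 := mem_enc_hi (n := n) (A := A) (B := B) (y := bar n x)
        (by unfold bar; omega) (by unfold bar; omega)
      rw [bar_bar (by omega)] at h3 h4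
      rw [h3, h4]
  · constructor
    · intro h; exact absurd (hT x h) hx
    · intro h; rw [mem_enc] at h; omega

theorem enc_bd {n : ℕ} {A B : Finset ℕ} : ∀ x ∈ enc n A B, 1 ≤ x ∧ x ≤ 2 * n := by
  intro x h; rw [mem_enc] at h; omega

theorem isColumn_sort {n : ℕ} {C : List ℕ} (h : IsColumn n C) :
    C = C.toFinset.sort (· ≤ ·) := by
  have h1 : C.Pairwise (· < ·) := List.isChain_iff_pairwise.1 h.1
  have h2 : C.Nodup := h1.imp (fun h => ne_of_lt h)
  exact ((List.toFinset_sort (r := (· ≤ ·)) h2).2 (h1.imp le_of_lt)).symm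

theorem sort_isColumn {n : ℕ} {S : Finset ℕ} (h : ∀ x ∈ S, 1 ≤ x ∧ x ≤ 2 * n) :
    IsColumn n (S.sort (· ≤ ·)) := by
  refine ⟨List.isChain_iff_pairwise.2 ?_, fun x hx => h x (by simpa using hx)⟩
  exact (Finset.sortedLT_sort S).pairwise

theorem sortCol_eq {L : List ℕ} {S : Finset ℕ} (h : L.Nodup) (h2 : ∀ x, x ∈ L ↔ x ∈ S) :
    sortCol L = S.sort (· ≤ ·) := by
  have hp : (sortCol L).Perm L := List.mergeSort_perm _ _
  have hs : (sortCol L).Pairwise (· ≤ ·) := by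
    have := List.pairwise_mergeSort' (· ≤ ·) L
    exact this
  have hS : S = (sortCol L).toFinset := by
    ext x; rw [List.mem_toFinset, hp.mem_iff, h2]
  rw [hS]
  exact ((List.toFinset_sort (r := (· ≤ ·)) (hp.nodup_iff.2 h)).2 hs).symm

theorem sort_erase (S : Finset ℕ) (x : ℕ) :
    (S.erase x).sort (· ≤ ·) = (S.sort (· ≤ ·)).erase x := by
  have h1 : ((S.sort (· ≤ ·)).erase x).Nodup := (Finset.sort_nodup _ _).erase _
  have h2 : ((S.sort (· ≤ ·)).erase x).Pairwise (· ≤ ·) :=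
    (Finset.pairwise_sort S (· ≤ ·)).sublist List.erase_sublist
  have h3 : S.erase x = ((S.sort (· ≤ ·)).erase x).toFinset := by
    ext y; simp [(Finset.sort_nodup _ _).mem_erase_iff]
  rw [h3]
  exact (List.toFinset_sort (r := (· ≤ ·)) h1).2 h2

theorem clt_getElem (S : Finset ℕ) (k : ℕ) (hk : k < S.card) :
    (S.sort (· ≤ ·)).getD k 0 ∈ S ∧ clt S ((S.sort (· ≤ ·)).getD k 0) = k := by
  have hk' : k < (S.sort (· ≤ ·)).length := by simpa using hk
  rw [List.getD_eq_getElem _ _ hk']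
  refine ⟨by rw [← Finset.mem_sort (r := (· ≤ ·))]; exact List.getElem_mem _, ?_⟩
  have hs := (Finset.sortedLT_sort S).strictMono_get
  have : S.filter (fun x => x < (S.sort (· ≤ ·))[k]) =
      (Finset.univ.filter (fun i : Fin (S.sort (· ≤ ·)).length => i < ⟨k, hk'⟩)).image
        (S.sort (· ≤ ·)).get := by
    ext x
    simp only [Finset.mem_filter, Finset.mem_image, Finset.mem_univ, true_and]
    constructor
    · rintro ⟨h1, h2⟩
      rw [← Finset.mem_sort (r := (· ≤ ·)), List.mem_iff_get] at h1
      obtain ⟨i, rfl⟩ := h1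
      exact ⟨i, hs.lt_iff_lt.1 h2, rfl⟩
    · rintro ⟨i, h1, rfl⟩
      exact ⟨by rw [← Finset.mem_sort (r := (· ≤ ·))]; exact List.get_mem _ _, hs h1⟩
  rw [clt, this, Finset.card_image_of_injective _ hs.injective]
  have h5 : (Finset.univ.filter (fun i : Fin (S.sort (· ≤ ·)).length => i < ⟨k, hk'⟩)) =
      Finset.Iio ⟨k, hk'⟩ := by ext i; simp
  rw [h5, Fin.card_Iio]

theorem clt_lt {S : Finset ℕ} {a b : ℕ} (ha : a ∈ S) (h : a < b) : clt S a < clt S b := by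
  have h1 := clt_succ S a
  rw [if_pos ha] at h1
  have h2 := clt_mono S (show a + 1 ≤ b from h)
  omega

theorem clt_card {S : Finset ℕ} {a : ℕ} (ha : a ∈ S) : clt S a < S.card := by
  have h1 := clt_add_cge S a
  have h2 := cge_succ S a
  rw [if_pos ha] at h2
  omega

theorem clt_inj {S : Finset ℕ} {a b : ℕ} (ha : a ∈ S) (hb : b ∈ S) (h : clt S a = clt S b) :
    a = b := by
  rcases lt_trichotomy a b with h1 | h1 | h1
  · have := clt_lt ha h1; omega
  · exact h1
  · have := clt_lt hb h1; omega

theorem sort_eraseIdx (S : Finset ℕ) (x : ℕ) (hx : x ∈ S) :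
    (S.erase x).sort (· ≤ ·) = (S.sort (· ≤ ·)).eraseIdx (clt S x) := by
  rw [sort_erase]
  have hc := clt_card hx
  obtain ⟨h1, h2⟩ := clt_getElem S _ hc
  have h3 := clt_inj h1 hx h2
  have hk' : clt S x < (S.sort (· ≤ ·)).length := by simpa using hc
  rw [List.getD_eq_getElem _ _ hk'] at h3
  conv_lhs => rw [← h3]
  exact (Finset.sort_nodup _ _).erase_getElem _ _

/-- row bookkeeping -/
theorem rows {L R : Finset ℕ} (hc : L.card = R.card) (hle : ∀ y, clt R y ≤ clt L y)
    {x β p : ℕ} (hp1 : 1 ≤ p) (hp : p ≤ R.card)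
    (hβ : β = (R.sort (· ≤ ·)).getD (p - 1) 0)
    (hx : x ∈ L) (hxβ : x ≤ β) (hb : clt L x = clt R x)
    (hmax : ∀ y ∈ L, x < y → y ≤ β → clt R y < clt L y) :
    ∃ q, 1 ≤ q ∧ q ≤ p ∧
      (∀ q', q < q' → q' ≤ p →
        (L.sort (· ≤ ·)).getD (q' - 1) 0 ≤ (R.sort (· ≤ ·)).getD (q' - 2) 0) ∧
      (2 ≤ q → (R.sort (· ≤ ·)).getD (q - 2) 0 < (L.sort (· ≤ ·)).getD (q - 1) 0) ∧
      (L.erase x).sort (· ≤ ·) = (L.sort (· ≤ ·)).eraseIdx (q - 1) := by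
  obtain ⟨hβ1, hβ2⟩ := clt_getElem R (p-1) (by omega)
  rw [← hβ] at hβ1 hβ2
  have hm := clt_mono R hxβ
  refine ⟨clt L x + 1, by omega, by omega, ?_, ?_, ?_⟩
  · intro q' h1 h2
    obtain ⟨y1, y2⟩ := clt_getElem L (q'-1) (by omega)
    obtain ⟨w1, w2⟩ := clt_getElem R (q'-2) (by omega)
    generalize (L.sort (· ≤ ·)).getD (q'-1) 0 = y at *
    generalize (R.sort (· ≤ ·)).getD (q'-2) 0 = w at *
    by_contra hlt
    push Not at hlt
    have hxy : x < y := by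
      by_contra h; push Not at h
      have := clt_mono L h; omega
    have hyβ : y ≤ β := by
      by_contra h; push Not at h
      have a1 := clt_mono L (show β + 1 ≤ y from h)
      have a2 := hle (β+1)
      have a3 := clt_succ R β
      rw [if_pos hβ1] at a3
      omega
    have := hmax y y1 hxy hyβ
    have := clt_lt w1 hlt
    omega
  · intro h
    have hc' := clt_card hx
    obtain ⟨y1, y2⟩ := clt_getElem L (clt L x + 1 -1) (by omega)
    obtain ⟨w1, w2⟩ := clt_getElem R (clt L x + 1 -2) (by omega)
    rw [clt_inj y1 hx (by omega)]
    by_contra h; push Not at h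
    have := clt_mono R h
    omega
  · simpa using sort_eraseIdx L x hx

structure Dec (n : ℕ) (C : List ℕ) (P M I J : Finset ℕ) : Prop where
  bP : ∀ x ∈ P, 1 ≤ x ∧ x ≤ n
  bM : ∀ x ∈ M, 1 ≤ x ∧ x ≤ n
  bI : ∀ x ∈ I, 1 ≤ x ∧ x ≤ n
  bJ : ∀ x ∈ J, 1 ≤ x ∧ x ≤ n
  PM : ∀ x ∈ P, x ∉ M
  PI : ∀ x ∈ P, x ∉ I
  PJ : ∀ x ∈ P, x ∉ J
  MI : ∀ x ∈ M, x ∉ I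
  MJ : ∀ x ∈ M, x ∉ J
  IJ : ∀ x ∈ I, x ∉ J
  hC : C = (enc n (P ∪ I) (M ∪ I)).sort (· ≤ ·)
  nonneg : ∀ x, cge J x ≤ cge I x
  bal : I.card = J.card
  gap : ∀ t, 1 ≤ t → t ≤ n → t ∉ P → t ∉ M → t ∉ I → t ∉ J → cge I t = cge J t


theorem splitJ_spec (n : ℕ) (C : List ℕ) (E : Finset ℕ)
    (hE : ∀ t, t ∈ E ↔ 1 ≤ t ∧ t ≤ n ∧ t ∉ C ∧ bar n t ∉ C) :
    ∀ (zs : List ℕ), zs.Pairwise (· > ·) → ∀ (J : Finset ℕ) (b : ℕ), (∀ z ∈ zs, z ∉ E) →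
      J ⊆ E → (∀ t ∈ J, t < b) → zs.length = J.card →
      (∀ x, cge J x ≤ cge zs.toFinset x) →
      (∀ e ∈ E, e ∉ J → e < b → cge zs.toFinset e = cge J e) →
      ∃ js, splitJ n C zs b = some js ∧ js.Nodup ∧ ∀ x, x ∈ js ↔ x ∈ J := by
  intro zs
  induction zs with
  | nil =>
    intro _ J b _ _ _ hlen _ _
    have : J = ∅ := by
      rw [← Finset.card_eq_zero]; simpa using hlen.symm
    subst this
    exact ⟨[], rfl, List.nodup_nil, by simp⟩
  | cons z zs ih =>
    intro hpw J b hzE hJE hJb hlen hnn hgap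
    rw [List.pairwise_cons] at hpw
    obtain ⟨hz, hpw⟩ := hpw
    have hznot : z ∉ zs.toFinset := by
      intro h; have := hz z (by simpa using h); omega
    have hcz : ∀ y, cge (z :: zs).toFinset y = cge zs.toFinset y + if y ≤ z then 1 else 0 := by
      intro y; rw [List.toFinset_cons, cge_insert hznot]
    have hne : J.Nonempty := by
      rw [← Finset.card_pos, ← hlen]; simp
    obtain ⟨t, htJ, htmax⟩ : ∃ t ∈ J, ∀ s ∈ J, s ≤ t :=
      ⟨J.max' hne, J.max'_mem hne, fun s hs => J.le_max' s hs⟩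
    have hJtop : ∀ y, t < y → cge J y = 0 := by
      intro y hy
      simp only [cge, Finset.card_eq_zero, Finset.filter_eq_empty_iff]
      intro x hx; have := htmax x hx; omega
    have hcJ : ∀ y, cge J y = cge (J.erase t) y + if y ≤ t then 1 else 0 :=
      fun y => cge_erase htJ y
    have hztop : ∀ y, z < y → cge zs.toFinset y = 0 := by
      intro y hy
      simp only [cge, Finset.card_eq_zero, Finset.filter_eq_empty_iff]
      intro x hx; have := hz x (by simpa using hx); omega
    have htz : t < z := by
      have hne' : t ≠ z := by rintro rfl; exact hzE t (by simp) (hJE htJ)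
      by_contra h
      have h1 := hnn t
      have h2 := hcz t
      have h3 := hztop t (by omega)
      have h4 := hcJ t
      simp only [le_refl, if_true] at h4
      rw [if_neg (by omega)] at h2
      omega
    have hpick : pickBelow n C (min b z) = some t := by
      unfold pickBelow
      rw [List.max?_eq_some_iff]
      constructor
      · simp only [List.mem_filter, List.mem_range, decide_eq_true_eq]
        exact ⟨lt_min (hJb t htJ) htz, (hE t).1 (hJE htJ)⟩
      · intro e he
        simp only [List.mem_filter, List.mem_range, decide_eq_true_eq] at he
        obtain ⟨he1, he2⟩ := he
        have heE := (hE e).2 he2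
        by_cases heJ : e ∈ J
        · exact htmax e heJ
        · have h1 := hgap e heE heJ (by omega)
          have h2 := hcz e
          rw [if_pos (by omega)] at h2
          by_contra h
          have := hJtop e (by omega)
          omega
    obtain ⟨js, hjs, hnd, hmem⟩ := ih hpw (J.erase t) t (fun z' hz' => hzE z' (by simp [hz']))
      ((Finset.erase_subset _ _).trans hJE)
      (fun s hs => lt_of_le_of_ne (htmax s (Finset.mem_of_mem_erase hs)) (Finset.ne_of_mem_erase hs))
      (by rw [Finset.card_erase_of_mem htJ, ← hlen]; simp)
      (by
        intro x
        have h1 := hnn x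
        have h2 := hcz x
        have h3 := hcJ x
        by_cases hx : x ≤ t
        · rw [if_pos (by omega)] at h2
          rw [if_pos hx] at h3
          omega
        · have := hJtop x (by omega)
          omega)
      (by
        intro e heE heJ het
        have heJ' : e ∉ J := fun h => heJ (Finset.mem_erase.2 ⟨by omega, h⟩)
        have h1 := hgap e heE heJ' (lt_trans het (hJb t htJ))
        have h2 := hcz e
        have h3 := hcJ e
        rw [if_pos (by omega)] at h2 h3
        omega)
    refine ⟨t :: js, ?_, ?_, ?_⟩
    · simp only [splitJ, hpick, hjs, Option.map_some]
    · rw [List.nodup_cons]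
      exact ⟨by rw [hmem]; simp, hnd⟩
    · intro x
      rw [List.mem_cons, hmem, Finset.mem_erase]
      constructor
      · rintro (rfl | h)
        · exact htJ
        · exact h.2
      · intro h
        by_cases hx : x = t
        · exact Or.inl hx
        · exact Or.inr ⟨hx, h⟩

theorem Ilist_pw (n : ℕ) (C : List ℕ) : (Ilist n C).Pairwise (· > ·) := by
  unfold Ilist
  rw [List.pairwise_reverse]
  exact List.pairwise_lt_range.filter _

theorem mem_Ilist {n : ℕ} {C : List ℕ} {z : ℕ} :
    z ∈ Ilist n C ↔ 1 ≤ z ∧ z ≤ n ∧ z ∈ C ∧ bar n z ∈ C := by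
  simp only [Ilist, List.mem_reverse, List.mem_filter, List.mem_range, decide_eq_true_eq]
  constructor
  · rintro ⟨h1, h2, h3⟩; exact ⟨h2, by omega, h3⟩
  · rintro ⟨h1, h2, h3⟩; exact ⟨by omega, h1, h3⟩

namespace Dec
variable {n : ℕ} {C : List ℕ} {P M I J : Finset ℕ}

theorem memC (h : Dec n C P M I J) (x : ℕ) : x ∈ C ↔ x ∈ enc n (P ∪ I) (M ∪ I) := by
  rw [h.hC, Finset.mem_sort]

theorem lo (h : Dec n C P M I J) {x : ℕ} (h1 : 1 ≤ x) (h2 : x ≤ n) : x ∈ C ↔ x ∈ P ∨ x ∈ I := by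
  rw [h.memC, mem_enc_lo h1 h2, Finset.mem_union]

theorem hi (h : Dec n C P M I J) {x : ℕ} (h1 : 1 ≤ x) (h2 : x ≤ n) :
    bar n x ∈ C ↔ x ∈ M ∨ x ∈ I := by
  rw [h.memC, mem_enc_hi h1 h2, Finset.mem_union]

theorem memI (h : Dec n C P M I J) (z : ℕ) : z ∈ Ilist n C ↔ z ∈ I := by
  rw [mem_Ilist]
  have := h.PM z
  have := h.bI z
  constructor
  · rintro ⟨h1, h2, h3, h4⟩
    rw [h.lo h1 h2] at h3; rw [h.hi h1 h2] at h4
    tauto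
  · intro hz
    obtain ⟨h1, h2⟩ := h.bI z hz
    rw [h.lo h1 h2, h.hi h1 h2]; tauto

theorem nodupC (h : Dec n C P M I J) : C.Nodup := by rw [h.hC]; exact Finset.sort_nodup _ _

theorem Jspec (h : Dec n C P M I J) : (Jlist n C).Nodup ∧ ∀ x, x ∈ Jlist n C ↔ x ∈ J := by
  have hI : (Ilist n C).toFinset = I := by
    ext x; rw [List.mem_toFinset, h.memI]
  have hE : ∀ t, t ∈ (Finset.Icc 1 n).filter (fun t => t ∉ C ∧ bar n t ∉ C) ↔
      1 ≤ t ∧ t ≤ n ∧ t ∉ C ∧ bar n t ∉ C := by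
    intro t; simp only [Finset.mem_filter, Finset.mem_Icc]; tauto
  obtain ⟨js, h1, h2, h3⟩ := splitJ_spec n C _ hE (Ilist n C) (Ilist_pw n C) J (n+1)
    (by
      intro z hz hz'
      rw [hE] at hz'
      rw [mem_Ilist] at hz
      tauto)
    (by
      intro t ht
      obtain ⟨a, b⟩ := h.bJ t ht
      rw [hE, h.lo a b, h.hi a b]
      have := h.PJ t
      have := h.MJ t
      have := h.IJ t
      tauto)
    (fun t ht => by have := h.bJ t ht; omega)
    (by rw [← h.bal, ← hI, List.toFinset_card_of_nodup]
        exact (Ilist_pw n C).imp (fun h => ne_of_gt h))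
    (by rw [hI]; exact h.nonneg)
    (by
      intro e he heJ _
      rw [hE] at he
      obtain ⟨a, b, he⟩ := he
      rw [h.lo a b, h.hi a b] at he
      rw [hI]
      exact h.gap e a b (by tauto) (by tauto) (by tauto) heJ)
  have : Jlist n C = js := by unfold Jlist JlistOpt; rw [h1]; rfl
  rw [this]; exact ⟨h2, h3⟩

theorem lCol_eq (h : Dec n C P M I J) : lCol n C = (enc n (P ∪ J) (M ∪ I)).sort (· ≤ ·) := by
  obtain ⟨j1, j2⟩ := h.Jspec
  have hbd : ∀ x ∈ C, 1 ≤ x ∧ x ≤ 2 * n := fun x hx => enc_bd x ((h.memC x).1 hx)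
  unfold lCol
  apply sortCol_eq
  · rw [List.nodup_append']
    refine ⟨h.nodupC.filter _, j1, ?_⟩
    intro x hx hx'
    rw [j2] at hx'
    obtain ⟨a, b⟩ := h.bJ x hx'
    have := List.mem_of_mem_filter hx
    rw [h.lo a b] at this
    have := h.PJ x
    have := h.IJ x
    tauto
  · intro x
    rw [← List.mem_toFinset]
    revert x
    rw [← Finset.ext_iff]
    apply enc_ext
    · intro x hx
      simp only [List.mem_toFinset, List.mem_append, List.mem_filter, j2] at hx
      rcases hx with hx | hx
      · exact hbd x hx.1
      · have := h.bJ x hx; omega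
    · intro y h1 h2
      simp only [List.mem_toFinset, List.mem_append, List.mem_filter, j2, decide_eq_true_eq,
        h.memI, h.lo h1 h2, Finset.mem_union]
      have := h.PI y
      tauto
    · intro y h1 h2
      simp only [List.mem_toFinset, List.mem_append, List.mem_filter, j2, decide_eq_true_eq,
        h.memI, h.hi h1 h2, Finset.mem_union]
      have a1 : bar n y ∉ I := fun hh => by have := h.bI _ hh; unfold bar at this; omega
      have a2 : bar n y ∉ J := fun hh => by have := h.bJ _ hh; unfold bar at this; omega
      tauto

theorem rCol_eq (h : Dec n C P M I J) : rCol n C = (enc n (P ∪ I) (M ∪ J)).sort (· ≤ ·) := by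
  obtain ⟨j1, j2⟩ := h.Jspec
  have hbd : ∀ x ∈ C, 1 ≤ x ∧ x ≤ 2 * n := fun x hx => enc_bd x ((h.memC x).1 hx)
  have hmap : ∀ (L : List ℕ) (S : Finset ℕ), (∀ x, x ∈ L ↔ x ∈ S) → (∀ x ∈ S, 1 ≤ x ∧ x ≤ n) →
      ∀ y, 1 ≤ y → y ≤ n → (bar n y ∈ L.map (bar n) ↔ y ∈ S) := by
    intro L S hL hS y h1 h2
    rw [List.mem_map]
    constructor
    · rintro ⟨a, ha, hb⟩
      rw [hL] at ha
      have := hS a ha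
      have : a = y := by unfold bar at hb; omega
      exact this ▸ ha
    · intro hy; exact ⟨y, (hL y).2 hy, rfl⟩
  have hmap2 : ∀ (L : List ℕ) (S : Finset ℕ), (∀ x, x ∈ L ↔ x ∈ S) → (∀ x ∈ S, 1 ≤ x ∧ x ≤ n) →
      ∀ y, y ≤ n → y ∉ L.map (bar n) := by
    intro L S hL hS y h2 hy
    rw [List.mem_map] at hy
    obtain ⟨a, ha, hb⟩ := hy
    rw [hL] at ha
    have := hS a ha
    unfold bar at hb; omega
  unfold rCol
  apply sortCol_eq
  · rw [List.nodup_append']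
    refine ⟨h.nodupC.filter _, ?_, ?_⟩
    · refine List.Nodup.map_on ?_ j1
      intro x hx y hy hxy
      rw [j2] at hx hy
      have := h.bJ x hx
      have := h.bJ y hy
      unfold bar at hxy; omega
    intro x hx hx'
    rw [List.mem_map] at hx'
    obtain ⟨y, hy, rfl⟩ := hx'
    rw [j2] at hy
    obtain ⟨a, b⟩ := h.bJ y hy
    have := List.mem_of_mem_filter hx
    rw [h.hi a b] at this
    have := h.MJ y
    have := h.IJ y
    tauto
  · intro x
    rw [← List.mem_toFinset]
    revert x
    rw [← Finset.ext_iff]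
    apply enc_ext
    · intro x hx
      simp only [List.mem_toFinset, List.mem_append, List.mem_filter, List.mem_map, j2] at hx
      rcases hx with hx | ⟨y, hx, rfl⟩
      · exact hbd x hx.1
      · have := h.bJ y hx; unfold bar; omega
    · intro y h1 h2
      have a1 := hmap2 _ _ h.memI h.bI y h2
      have a2 := hmap2 _ _ j2 h.bJ y h2
      simp only [List.mem_toFinset, List.mem_append, List.mem_filter, decide_eq_true_eq,
        h.lo h1 h2, Finset.mem_union]
      tauto
    · intro y h1 h2
      have a1 := hmap _ _ h.memI h.bI y h1 h2
      have a2 := hmap _ _ j2 h.bJ y h1 h2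
      have := h.MI y
      simp only [List.mem_toFinset, List.mem_append, List.mem_filter, decide_eq_true_eq,
        h.hi h1 h2, Finset.mem_union, a1, a2]
      tauto

theorem Phi_eq (h : Dec n C P M I J) : PhiCol n C = (enc n (P ∪ J) (M ∪ J)).sort (· ≤ ·) := by
  unfold PhiCol
  rw [h.lCol_eq, h.rCol_eq]
  apply sortCol_eq
  · rw [List.nodup_append']
    refine ⟨(Finset.sort_nodup _ _).filter _, (Finset.sort_nodup _ _).filter _, ?_⟩
    intro x hx hx'
    have a1 := (List.mem_filter.1 hx).2
    have a2 := (List.mem_filter.1 hx').2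
    simp only [decide_eq_true_eq] at a1 a2
    omega
  · intro x
    simp only [List.mem_append, List.mem_filter, Finset.mem_sort, decide_eq_true_eq, mem_enc]
    constructor
    · rintro (⟨h1 | h1, h2⟩ | ⟨h1 | h1, h2⟩)
      · exact Or.inl h1
      · omega
      · omega
      · exact Or.inr h1
    · rintro (h1 | h1)
      · exact Or.inl ⟨Or.inl h1, h1.2.1⟩
      · exact Or.inr ⟨Or.inr h1, h1.1⟩

theorem isCol (h : Dec n C P M I J) : IsColumn n C := by
  rw [h.hC]; exact sort_isColumn enc_bd

end Dec

theorem count_id {n : ℕ} {C : List ℕ} (hnd : C.Nodup) (hbd : ∀ x ∈ C, 1 ≤ x ∧ x ≤ 2 * n)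
    {I E : Finset ℕ}
    (hI : ∀ t, t ∈ I ↔ 1 ≤ t ∧ t ≤ n ∧ t ∈ C ∧ bar n t ∈ C)
    (hE : ∀ t, t ∈ E ↔ 1 ≤ t ∧ t ≤ n ∧ t ∉ C ∧ bar n t ∉ C) (z : ℕ) (hz : z ≤ n) :
    C.countP (fun x => decide (x ≤ z ∨ bar n z ≤ x)) + clt E (z+1) = z + clt I (z+1) := by
  have h1 : C.countP (fun x => decide (x ≤ z ∨ bar n z ≤ x)) =
      clt C.toFinset (z+1) + cge C.toFinset (bar n z) := by
    rw [List.countP_eq_length_filter, ← List.toFinset_card_of_nodup (hnd.filter _), clt, cge,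
      ← Finset.card_union_of_disjoint]
    · congr 1
      ext x
      simp only [List.mem_toFinset, List.mem_filter, decide_eq_true_eq, Finset.mem_union,
        Finset.mem_filter, Nat.lt_succ_iff]
      tauto
    · rw [Finset.disjoint_left]
      intro x hx hx'
      simp only [Finset.mem_filter] at hx hx'
      unfold bar at hx'
      omega
  rw [h1]
  clear h1
  induction z with
  | zero =>
    have a0 : 0 ∉ C := fun h => by have := hbd 0 h; omega
    have aE : 0 ∉ E := fun h => by have := (hE 0).1 h; omega
    have aI : 0 ∉ I := fun h => by have := (hI 0).1 h; omega
    have a1 : cge C.toFinset (bar n 0) = 0 := by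
      apply cge_top; intro x hx; have := hbd x (by simpa using hx); omega
    simp [clt_succ, clt_zero, a0, aE, aI, a1]
  | succ z ih =>
    have ih := ih (by omega)
    have b1 := cge_succ C.toFinset (bar n (z+1))
    rw [show bar n (z+1) + 1 = bar n z by unfold bar; omega] at b1
    have b2 := clt_succ C.toFinset (z+1)
    have b3 := clt_succ I (z+1)
    have b4 := clt_succ E (z+1)
    have c1 := hI (z+1)
    have c2 := hE (z+1)
    simp only [List.mem_toFinset] at b1 b2
    by_cases d1 : z + 1 ∈ C <;> by_cases d2 : bar n (z+1) ∈ C <;>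
      simp only [d1, d2, hz, true_and, and_true, not_true, not_false_eq_true, and_false,
        iff_false, iff_true, Nat.le_add_left, false_and] at b1 b2 c1 c2 <;>
      simp only [c1, c2, if_true, if_false] at b1 b2 b3 b4 <;> omega


theorem greedy_exists (n : ℕ) (I E : Finset ℕ) (hI : ∀ x ∈ I, 1 ≤ x ∧ x ≤ n)
    (hE : ∀ x ∈ E, 1 ≤ x ∧ x ≤ n) (hIE : ∀ x ∈ I, x ∉ E)
    (hall : ∀ z ∈ I, clt I (z+1) ≤ clt E (z+1)) :
    ∃ J, J ⊆ E ∧ (∀ x, cge J x ≤ cge I x) ∧ I.card = J.card ∧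
      ∀ t ∈ E, t ∉ J → cge I t = cge J t := by
  have key : ∀ k s, s + k = n + 1 → ∃ J, J ⊆ E ∧ (∀ t ∈ J, s ≤ t) ∧
      (∀ x, s ≤ x → cge J x ≤ cge I x) ∧ ∀ t ∈ E, t ∉ J → s ≤ t → cge I t = cge J t := by
    intro k
    induction k with
    | zero =>
      intro s hs
      refine ⟨∅, by simp, by simp, by simp [cge], ?_⟩
      intro t ht _ hst
      have := hE t ht; omega
    | succ k ih =>
      intro u hs
      obtain ⟨J, j1, j2, j3, j4⟩ := ih (u+1) (by omega)
      have huJ : u ∉ J := fun h => by have := j2 u h; omega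
      have c1 := cge_succ I u
      have c2 := cge_succ J u
      have c3 := j3 (u+1) le_rfl
      rw [if_neg huJ] at c2
      by_cases hu : u ∈ E ∧ cge J (u+1) < cge I (u+1)
      · refine ⟨insert u J, ?_, ?_, ?_, ?_⟩
        · intro x hx
          rcases Finset.mem_insert.1 hx with rfl | hx
          · exact hu.1
          · exact j1 hx
        · intro x hx
          rcases Finset.mem_insert.1 hx with rfl | hx
          · exact le_rfl
          · have := j2 x hx; omega
        · intro x hx
          rw [cge_insert huJ]
          rcases Nat.eq_or_lt_of_le hx with rfl | hx
          · have := hu.2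
            simp only [le_refl, if_true]; omega
          · rw [if_neg (by omega)]
            have := j3 x hx; omega
        · intro t ht htJ hut
          rw [Finset.mem_insert, not_or] at htJ
          rw [cge_insert huJ, if_neg (by omega)]
          exact j4 t ht htJ.2 (by omega)
      · refine ⟨J, j1, ?_, ?_, ?_⟩
        · intro x hx; have := j2 x hx; omega
        · intro x hx
          rcases Nat.eq_or_lt_of_le hx with rfl | hx
          · omega
          · exact j3 x hx
        · intro t ht htJ hut
          rcases Nat.eq_or_lt_of_le hut with rfl | hx
          · have h1 : u ∉ I := fun h => hIE u h ht
            rw [if_neg h1] at c1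
            have : ¬ cge J (u+1) < cge I (u+1) := fun h => hu ⟨ht, h⟩
            omega
          · exact j4 t ht htJ hx
  obtain ⟨J, j1, _, j3, j4⟩ := key (n+1) 0 (by omega)
  refine ⟨J, j1, fun x => j3 x (Nat.zero_le _), ?_, fun t h1 h2 => j4 t h1 h2 (Nat.zero_le _)⟩
  have hex : ∃ s, cge I s = cge J s := ⟨n+1, by
    rw [cge_top (fun x hx => (hI x hx).2), cge_top (fun x hx => (hE x (j1 hx)).2)]⟩
  classical
  rcases hs : Nat.find hex with _ | z
  · have := Nat.find_spec hex
    rw [hs, cge_zero, cge_zero] at this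
    exact this
  · have h1 := Nat.find_spec hex
    rw [hs] at h1
    have h2 : ∀ t, t ≤ z → cge I t ≠ cge J t := fun t ht => Nat.find_min hex (by omega)
    have hz : z ∈ I := by
      by_contra hz
      have c1 := cge_succ I z
      have c2 := cge_succ J z
      rw [if_neg hz] at c1
      have := h2 z le_rfl
      have := j3 z (Nat.zero_le _)
      omega
    have h3 : clt E (z+1) ≤ clt J (z+1) := by
      apply Finset.card_le_card
      intro t ht
      rw [Finset.mem_filter] at ht ⊢
      refine ⟨?_, ht.2⟩
      by_contra htJ
      exact h2 t (by omega) (j4 t ht.1 htJ (Nat.zero_le _))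
    have h4 := hall z hz
    have h5 := clt_add_cge I (z+1)
    have h6 := clt_add_cge J (z+1)
    have h7 := j3 0 le_rfl
    rw [cge_zero, cge_zero] at h7
    omega

theorem dec_exists {n : ℕ} {C : List ℕ} (h : IsColumn n C) (ho : OCC n C) :
    ∃ P M I J, Dec n C P M I J := by
  have hnd : C.Nodup := by rw [isColumn_sort h]; exact Finset.sort_nodup _ _
  have mem (f : ℕ → Prop) [DecidablePred f] (t : ℕ) :
      t ∈ (Finset.Icc 1 n).filter f ↔ 1 ≤ t ∧ t ≤ n ∧ f t := by
    simp only [Finset.mem_filter, Finset.mem_Icc]; tauto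
  have mP := mem (fun t => t ∈ C ∧ bar n t ∉ C)
  have mM := mem (fun t => t ∉ C ∧ bar n t ∈ C)
  have mI := mem (fun t => t ∈ C ∧ bar n t ∈ C)
  have mE := mem (fun t => t ∉ C ∧ bar n t ∉ C)
  generalize (Finset.Icc 1 n).filter (fun t => t ∈ C ∧ bar n t ∉ C) = P at *
  generalize (Finset.Icc 1 n).filter (fun t => t ∉ C ∧ bar n t ∈ C) = M at *
  generalize (Finset.Icc 1 n).filter (fun t => t ∈ C ∧ bar n t ∈ C) = I at *
  generalize (Finset.Icc 1 n).filter (fun t => t ∉ C ∧ bar n t ∉ C) = E at *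
  obtain ⟨J, j1, j2, j3, j4⟩ := greedy_exists n I E
    (fun x hx => by rw [mI] at hx; omega) (fun x hx => by rw [mE] at hx; omega)
    (fun x hx hx' => by rw [mE] at hx'; rw [mI] at hx; tauto)
    (by
      intro z hz
      have hz' := (mI z).1 hz
      have h1 := ho z hz'.1 hz'.2.1 hz'.2.2.1 hz'.2.2.2
      have h2 := count_id hnd h.2 mI mE z hz'.2.1
      omega)
  have mJ : ∀ t ∈ J, 1 ≤ t ∧ t ≤ n ∧ t ∉ C ∧ bar n t ∉ C := fun t ht => (mE t).1 (j1 ht)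
  refine ⟨P, M, I, J, ?_⟩
  constructor
  · intro x hx; rw [mP] at hx; omega
  · intro x hx; rw [mM] at hx; omega
  · intro x hx; rw [mI] at hx; omega
  · intro x hx; have := mJ x hx; omega
  · intro x; rw [mP, mM]; tauto
  · intro x; rw [mP, mI]; tauto
  · intro x hx hx'; rw [mP] at hx; have := mJ x hx'; tauto
  · intro x; rw [mM, mI]; tauto
  · intro x hx hx'; rw [mM] at hx; have := mJ x hx'; tauto
  · intro x hx hx'; rw [mI] at hx; have := mJ x hx'; tauto
  · rw [isColumn_sort h]
    congr 1
    apply enc_ext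
    · intro x hx; exact h.2 x (by simpa using hx)
    · intro y h1 h2
      rw [List.mem_toFinset, Finset.mem_union, mP, mI]; tauto
    · intro y h1 h2
      rw [List.mem_toFinset, Finset.mem_union, mM, mI]; tauto
  · exact j2
  · exact j3
  · intro t h1 h2 h3 h4 h5 h6
    refine j4 t ?_ h6
    rw [mP] at h3; rw [mM] at h4; rw [mI] at h5; rw [mE]
    tauto

theorem Dec.occ {n : ℕ} {C : List ℕ} {P M I J : Finset ℕ} (h : Dec n C P M I J) : OCC n C := by
  intro z h1 h2 h3 h4
  have mE (t : ℕ) :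
      t ∈ (Finset.Icc 1 n).filter (fun t => t ∉ C ∧ bar n t ∉ C) ↔
        1 ≤ t ∧ t ≤ n ∧ t ∉ C ∧ bar n t ∉ C := by
    simp only [Finset.mem_filter, Finset.mem_Icc]; tauto
  have mI : ∀ t, t ∈ I ↔ 1 ≤ t ∧ t ≤ n ∧ t ∈ C ∧ bar n t ∈ C := by
    intro t; rw [← h.memI, mem_Ilist]
  have hc := count_id h.nodupC h.isCol.2 mI mE z h2
  have h5 : J ⊆ (Finset.Icc 1 n).filter (fun t => t ∉ C ∧ bar n t ∉ C) := by
    intro t ht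
    obtain ⟨a, b⟩ := h.bJ t ht
    rw [mE, h.lo a b, h.hi a b]
    have := h.PJ t
    have := h.MJ t
    have := h.IJ t
    tauto
  have h6 := clt_sub h5 (z+1)
  have h7 := clt_add_cge I (z+1)
  have h8 := clt_add_cge J (z+1)
  have h9 := h.nonneg (z+1)
  have h10 := h.bal
  omega

theorem Dec.inj {n : ℕ} {C C' : List ℕ} {P M I J P' M' I' J' : Finset ℕ}
    (h : Dec n C P M I J) (h' : Dec n C' P' M' I' J') (he : PhiCol n C = PhiCol n C') :
    C = C' := by
  rw [h.Phi_eq, h'.Phi_eq] at he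
  have he : enc n (P ∪ J) (M ∪ J) = enc n (P' ∪ J') (M' ∪ J') := by
    rw [← Finset.sort_toFinset (r := (· ≤ ·)) (s := enc n (P ∪ J) (M ∪ J)), he,
      Finset.sort_toFinset]
  have hh : ∀ y, 1 ≤ y → y ≤ n → (y ∈ P ↔ y ∈ P') ∧ (y ∈ M ↔ y ∈ M') ∧ (y ∈ J ↔ y ∈ J') := by
    intro y h1 h2
    have e1 := mem_enc_lo (A := P ∪ J) (B := M ∪ J) h1 h2
    have e2 := mem_enc_hi (A := P ∪ J) (B := M ∪ J) h1 h2
    rw [he, mem_enc_lo h1 h2] at e1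
    rw [he, mem_enc_hi h1 h2] at e2
    simp only [Finset.mem_union] at e1 e2
    have := h.PM y
    have := h.PJ y
    have := h.MJ y
    have := h'.PM y
    have := h'.PJ y
    have := h'.MJ y
    clear he
    refine ⟨?_, ?_, ?_⟩ <;> grind
  have hP : P = P' := by
    ext y; constructor
    · intro hy; obtain ⟨a, b⟩ := h.bP y hy; exact (hh y a b).1.1 hy
    · intro hy; obtain ⟨a, b⟩ := h'.bP y hy; exact (hh y a b).1.2 hy
  have hM : M = M' := by
    ext y; constructor
    · intro hy; obtain ⟨a, b⟩ := h.bM y hy; exact (hh y a b).2.1.1 hy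
    · intro hy; obtain ⟨a, b⟩ := h'.bM y hy; exact (hh y a b).2.1.2 hy
  have hJ : J = J' := by
    ext y; constructor
    · intro hy; obtain ⟨a, b⟩ := h.bJ y hy; exact (hh y a b).2.2.1 hy
    · intro hy; obtain ⟨a, b⟩ := h'.bJ y hy; exact (hh y a b).2.2.2 hy
  subst hP hM hJ
  have key : ∀ t, cge I t = cge I' t ∧ (t ∈ I ↔ t ∈ I') := by
    have step : ∀ t, cge I t = cge I' t → (t ∈ I ↔ t ∈ I') := by
      intro t ht
      have a1 := cge_succ I t
      have a2 := cge_succ I' t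
      have a3 := cge_succ J t
      have b1 := h.nonneg (t+1)
      have b2 := h'.nonneg (t+1)
      constructor
      · intro hI
        by_contra hI'
        obtain ⟨c1, c2⟩ := h.bI t hI
        have c3 := h'.gap t c1 c2 (fun hx => h.PI t hx hI) (fun hx => h.MI t hx hI) hI' (h.IJ t hI)
        rw [if_pos hI] at a1
        rw [if_neg hI'] at a2
        rw [if_neg (h.IJ t hI)] at a3
        omega
      · intro hI'
        by_contra hI
        obtain ⟨c1, c2⟩ := h'.bI t hI'
        have c3 := h.gap t c1 c2 (fun hx => h'.PI t hx hI') (fun hx => h'.MI t hx hI') hI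
          (h'.IJ t hI')
        rw [if_neg hI] at a1
        rw [if_pos hI'] at a2
        rw [if_neg (h'.IJ t hI')] at a3
        omega
    intro t
    induction t with
    | zero =>
      have : cge I 0 = cge I' 0 := by rw [cge_zero, cge_zero, h.bal, h'.bal]
      exact ⟨this, step 0 this⟩
    | succ t ih =>
      have a1 := cge_succ I t
      have a2 := cge_succ I' t
      obtain ⟨i1, i2⟩ := ih
      have : cge I (t+1) = cge I' (t+1) := by
        by_cases ht : t ∈ I
        · rw [if_pos ht] at a1
          rw [if_pos (i2.1 ht)] at a2
          omega
        · rw [if_neg ht] at a1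
          rw [if_neg (fun hx => ht (i2.2 hx))] at a2
          omega
      exact ⟨this, step _ this⟩
  have hI : I = I' := by ext t; exact (key t).2
  subst hI
  rw [h.hC, h'.hC]

theorem Dec.PhiInv {n : ℕ} {C : List ℕ} {P M I J : Finset ℕ} (h : Dec n C P M I J)
    {D : List ℕ} (hD : PhiCol n C = D) : PhiInvF n D = C := by
  have hex : ∃ C, IsColumn n C ∧ OCC n C ∧ PhiCol n C = D := ⟨C, h.isCol, h.occ, hD⟩
  unfold PhiInvF
  rw [dif_pos hex]
  obtain ⟨a, b, c⟩ := hex.choose_spec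
  obtain ⟨P', M', I', J', h'⟩ := dec_exists a b
  exact h'.inj h (c.trans hD.symm)

theorem Dec.delta {n : ℕ} {C : List ℕ} {P M I J : Finset ℕ} (h : Dec n C P M I J) (y : ℕ) :
    clt (enc n (P ∪ J) (M ∪ I)) y + cge J (if y ≤ n + 1 then y else 2 * n + 2 - y) =
    clt (enc n (P ∪ I) (M ∪ J)) y + cge I (if y ≤ n + 1 then y else 2 * n + 2 - y) := by
  induction y with
  | zero => simp [clt_zero, cge_zero, h.bal]
  | succ y ih =>
    have h0I : 0 ∉ I := fun hx => by have := h.bI 0 hx; omega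
    have h0J : 0 ∉ J := fun hx => by have := h.bJ 0 hx; omega
    have out : (y < 1 ∨ 2 * n < y) → ∀ A B, y ∉ enc n A B := by
      intro hy A B hx; have := enc_bd y hx; omega
    rw [clt_succ, clt_succ]
    by_cases hy : y ≤ n
    · rw [if_pos (show y ≤ n + 1 by omega)] at ih
      rw [if_pos (show y + 1 ≤ n + 1 by omega)]
      have a1 := cge_succ I y
      have a2 := cge_succ J y
      rcases Nat.eq_zero_or_pos y with rfl | hpos
      · rw [if_neg h0I] at a1
        rw [if_neg h0J] at a2
        rw [if_neg (out (by omega) (P ∪ J) (M ∪ I)), if_neg (out (by omega) (P ∪ I) (M ∪ J))]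
        omega
      · simp only [mem_enc_lo hpos hy, Finset.mem_union]
        have b1 := h.PI y
        have b2 := h.PJ y
        by_cases c1 : y ∈ P <;> by_cases c2 : y ∈ I <;> by_cases c3 : y ∈ J <;>
          simp [c1, c2, c3] at a1 a2 b1 b2 ⊢ <;> omega
    · rw [if_neg (show ¬ y + 1 ≤ n + 1 by omega)]
      have e : (if y ≤ n + 1 then y else 2 * n + 2 - y) = 2 * n + 2 - y := by
        split_ifs <;> omega
      rw [e] at ih
      by_cases hy2 : y ≤ 2 * n
      · obtain ⟨z, hz⟩ : ∃ z, z + y = 2 * n + 1 := ⟨2 * n + 1 - y, by omega⟩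
        have hyz : y = bar n z := by unfold bar; omega
        rw [show 2 * n + 2 - y = z + 1 by omega] at ih
        rw [show 2 * n + 2 - (y + 1) = z by omega]
        have a1 := cge_succ I z
        have a2 := cge_succ J z
        rw [hyz] at ih ⊢
        simp only [mem_enc_hi (show 1 ≤ z by omega) (show z ≤ n by omega), Finset.mem_union]
        have b1 := h.MI z
        have b2 := h.MJ z
        by_cases c1 : z ∈ M <;> by_cases c2 : z ∈ I <;> by_cases c3 : z ∈ J <;>
          simp [c1, c2, c3] at a1 a2 b1 b2 ⊢ <;> omega
      · rw [if_neg (out (by omega) (P ∪ J) (M ∪ I)), if_neg (out (by omega) (P ∪ I) (M ∪ J))]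
        rw [show 2 * n + 2 - (y+1) = 0 by omega, cge_zero, cge_zero]
        have := h.bal
        rcases Nat.lt_or_ge (2 * n + 1) y with h3 | h3
        · rw [show 2 * n + 2 - y = 0 by omega, cge_zero, cge_zero] at ih
          omega
        · rw [show 2 * n + 2 - y = 0 + 1 by omega] at ih
          have a1 := cge_succ I 0
          have a2 := cge_succ J 0
          rw [if_neg h0I, cge_zero] at a1
          rw [if_neg h0J, cge_zero] at a2
          omega

theorem enc_erase_lo {n : ℕ} {A B A' B' : Finset ℕ} {x : ℕ} (h1 : 1 ≤ x) (h2 : x ≤ n)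
    (hA : ∀ y, y ∈ A' ↔ y ≠ x ∧ y ∈ A) (hB : ∀ y, y ∈ B' ↔ y ∈ B) :
    enc n A' B' = (enc n A B).erase x := by
  symm
  apply enc_ext
  · intro y hy; exact enc_bd y (Finset.mem_of_mem_erase hy)
  · intro y a b; rw [Finset.mem_erase, mem_enc_lo a b, hA]
  · intro y a b; rw [Finset.mem_erase, mem_enc_hi a b, hB]
    have : bar n y ≠ x := by unfold bar; omega
    tauto

theorem enc_erase_hi {n : ℕ} {A B A' B' : Finset ℕ} {x : ℕ} (h1 : 1 ≤ x) (h2 : x ≤ n)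
    (hA : ∀ y, y ∈ A' ↔ y ∈ A) (hB : ∀ y, y ∈ B' ↔ y ≠ x ∧ y ∈ B) :
    enc n A' B' = (enc n A B).erase (bar n x) := by
  symm
  apply enc_ext
  · intro y hy; exact enc_bd y (Finset.mem_of_mem_erase hy)
  · intro y a b; rw [Finset.mem_erase, mem_enc_lo a b, hA]
    have : y ≠ bar n x := by unfold bar; omega
    tauto
  · intro y a b; rw [Finset.mem_erase, mem_enc_hi a b, hB]
    have : bar n y ≠ bar n x ↔ y ≠ x := by unfold bar; omega
    tauto

theorem caseA {n : ℕ} {C : List ℕ} {P M I J : Finset ℕ} (h : Dec n C P M I J)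
    {β : ℕ} (hβ1 : 1 ≤ β) (hβn : β ≤ n) (hβ : β ∈ P ∨ β ∈ I) :
    ∃ x P' M' I' J', Dec n (C.erase β) P' M' I' J' ∧ 1 ≤ x ∧ x ≤ β ∧
      x ∈ P ∪ J ∧ cge I x = cge J x ∧ (∀ y, x < y → y ≤ β → cge J y < cge I y) ∧
      enc n (P' ∪ J') (M' ∪ I') = (enc n (P ∪ J) (M ∪ I)).erase x := by
  classical
  have e0 : cge I 0 = cge J 0 := by rw [cge_zero, cge_zero, h.bal]
  obtain ⟨x, hxβ, hx, hmax⟩ : ∃ x, x ≤ β ∧ cge I x = cge J x ∧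
      ∀ y, x < y → y ≤ β → cge J y < cge I y := by
    refine ⟨Nat.findGreatest (fun y => cge I y = cge J y) β, Nat.findGreatest_le _,
      Nat.findGreatest_spec (P := fun y => cge I y = cge J y) (Nat.zero_le β) e0, ?_⟩
    intro y h1 h2
    have := Nat.findGreatest_is_greatest h1 h2
    have := h.nonneg y
    omega
  have a1 := cge_succ I x
  have a2 := cge_succ J x
  have a3 := h.nonneg (x+1)
  have hxI : x ∉ I := by
    intro hI
    rw [if_pos hI] at a1; rw [if_neg (h.IJ x hI)] at a2
    omega
  have hxJ : x < β → x ∈ J := by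
    intro hlt
    by_contra hJ
    rw [if_neg hJ] at a2
    have := hmax (x+1) (by omega) (by omega)
    omega
  have hC : ∀ A B : Finset ℕ, (∀ y, y ∈ A ↔ y ≠ β ∧ y ∈ P ∪ I) → (∀ y, y ∈ B ↔ y ∈ M ∪ I) →
      C.erase β = (enc n A B).sort (· ≤ ·) := by
    intro A B hA hB
    rw [enc_erase_lo hβ1 hβn hA hB, sort_erase, ← h.hC]
  obtain ⟨bP, bM, bI, bJ, PM, PI, PJ, MI, MJ, IJ, _, nonneg, bal, gap⟩ := h
  rcases hβ with hβ | hβ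
  · have hβJ : β ∉ J := PJ β hβ
    have hxm : x ∈ insert β J := by
      rw [Finset.mem_insert]
      rcases Nat.eq_or_lt_of_le hxβ with h1 | h1
      · exact Or.inl h1
      · exact Or.inr (hxJ h1)
    have hx1 : 1 ≤ x := by
      rcases Finset.mem_insert.1 hxm with h1 | h1
      · omega
      · exact (bJ x h1).1
    have cJ : ∀ y, cge J y + (if y ≤ β then 1 else 0) =
        cge ((insert β J).erase x) y + if y ≤ x then 1 else 0 := by
      intro y; rw [← cge_insert hβJ, ← cge_erase hxm]
    refine ⟨x, P.erase β, M, I, (insert β J).erase x, ?_, hx1, hxβ, ?_, hx, hmax, ?_⟩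
    · constructor
      · grind
      · grind
      · grind
      · grind
      · grind
      · grind
      · grind
      · grind
      · grind
      · grind
      · apply hC <;> grind
      · intro y
        have := cJ y
        have := nonneg y
        have := hmax y
        split_ifs at * <;> omega
      · have := cJ 0
        simp only [Nat.zero_le, if_true, cge_zero] at this
        omega
      · intro t t1 t2 t3 t4 t5 t6
        have hc := cJ t
        have := hmax t
        by_cases htx : t = x
        · subst htx
          rw [if_pos hxβ, if_pos le_rfl] at hc
          omega
        · have := gap t t1 t2 (by grind) t4 t5 (by grind)
          split_ifs at * <;> omega
    · grind
    · apply enc_erase_lo hx1 (by omega) <;> grind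
  · have hlt : x < β := by
      rcases Nat.eq_or_lt_of_le hxβ with h1 | h1
      · exact absurd (h1 ▸ hβ) hxI
      · exact h1
    have hxm := hxJ hlt
    have hx1 := (bJ x hxm).1
    have cJ := fun y => cge_erase hxm y
    have cI := fun y => cge_erase hβ y
    refine ⟨x, P, insert β M, I.erase β, J.erase x, ?_, hx1, hxβ, ?_, hx, hmax, ?_⟩
    · constructor
      · grind
      · grind
      · grind
      · grind
      · grind
      · grind
      · grind
      · grind
      · grind
      · grind
      · apply hC <;> grind
      · intro y
        have := cJ y
        have := cI y
        have := nonneg y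
        have := hmax y
        split_ifs at * <;> omega
      · rw [Finset.card_erase_of_mem hβ, Finset.card_erase_of_mem hxm, bal]
      · intro t t1 t2 t3 t4 t5 t6
        have := cJ t
        have := cI t
        have := hmax t
        have : t = x ∨ cge I t = cge J t := by
          by_cases htx : t = x
          · exact Or.inl htx
          · exact Or.inr (gap t t1 t2 (by grind) (by grind) (by grind) (by grind))
        rcases this with rfl | this
        · split_ifs at * <;> omega
        · split_ifs at * <;> omega
    · grind
    · apply enc_erase_lo hx1 (by omega) <;> grind

theorem caseB {n : ℕ} {C : List ℕ} {P M I J : Finset ℕ} (h : Dec n C P M I J)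
    {b : ℕ} (hb1 : 1 ≤ b) (hbn : b ≤ n) (hb : b ∈ M ∨ b ∈ J) :
    ∃ z C' P' M' I' J', Dec n C' P' M' I' J' ∧ PhiCol n C' = (PhiCol n C).erase (bar n b) ∧
      b ≤ z ∧ z ≤ n ∧
      z ∈ M ∪ I ∧ cge I (z+1) = cge J (z+1) ∧
      (∀ y, b ≤ y → y < z → cge J (y+1) < cge I (y+1)) ∧
      enc n (P' ∪ J') (M' ∪ I') = (enc n (P ∪ J) (M ∪ I)).erase (bar n z) := by
  classical
  have hex : ∃ z, b ≤ z ∧ cge I (z+1) = cge J (z+1) := ⟨n, hbn, by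
    rw [cge_top (fun x hx => (h.bI x hx).2), cge_top (fun x hx => (h.bJ x hx).2)]⟩
  obtain ⟨z, hbz, hz, hzn, hmin⟩ : ∃ z, b ≤ z ∧ cge I (z+1) = cge J (z+1) ∧ z ≤ n ∧
      ∀ y, b ≤ y → y < z → cge J (y+1) < cge I (y+1) := by
    refine ⟨Nat.find hex, (Nat.find_spec hex).1, (Nat.find_spec hex).2, ?_, ?_⟩
    · apply Nat.find_min' hex
      exact ⟨hbn, by
        rw [cge_top (fun x hx => (h.bI x hx).2), cge_top (fun x hx => (h.bJ x hx).2)]⟩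
    · intro y h1 h2
      have := Nat.find_min hex h2
      have := h.nonneg (y+1)
      have : ¬ cge I (y+1) = cge J (y+1) := fun hh => by tauto
      omega
  have hmin' : ∀ y, b < y → y ≤ z → cge J y < cge I y := by
    intro y h1 h2
    have := hmin (y-1) (by omega) (by omega)
    rwa [show y - 1 + 1 = y by omega] at this
  have a1 := cge_succ I z
  have a2 := cge_succ J z
  have a3 := h.nonneg z
  have hzJ : z ∉ J := by
    intro hJ
    rw [if_pos hJ] at a2; rw [if_neg (fun hI => h.IJ z hI hJ)] at a1
    omega
  have hzI : b < z → z ∈ I := by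
    intro hlt
    by_contra hI
    rw [if_neg hI] at a1
    have := hmin' z (by omega) (by omega)
    omega
  have hPhi := h.Phi_eq
  rw [hPhi]
  obtain ⟨bP, bM, bI, bJ, PM, PI, PJ, MI, MJ, IJ, _, nonneg, bal, gap⟩ := h
  rcases hb with hb | hb
  · have hbI : b ∉ I := MI b hb
    have hzm : z ∈ insert b I := by
      rw [Finset.mem_insert]
      rcases Nat.eq_or_lt_of_le hbz with h1 | h1
      · exact Or.inl h1.symm
      · exact Or.inr (hzI h1)
    have cI : ∀ y, cge I y + (if y ≤ b then 1 else 0) =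
        cge ((insert b I).erase z) y + if y ≤ z then 1 else 0 := by
      intro y; rw [← cge_insert hbI, ← cge_erase hzm]
    have hD : Dec n ((enc n (P ∪ (insert b I).erase z) (M.erase b ∪ (insert b I).erase z)).sort
        (· ≤ ·)) P (M.erase b) ((insert b I).erase z) J := by
      constructor
      · grind
      · grind
      · grind
      · grind
      · grind
      · grind
      · grind
      · grind
      · grind
      · grind
      · rfl
      · intro y
        have := cI y
        have := nonneg y
        have := hmin' y
        split_ifs at * <;> omega
      · have := cI 0
        simp only [Nat.zero_le, if_true, cge_zero] at this
        omega
      · intro t t1 t2 t3 t4 t5 t6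
        have := cI t
        have := hmin' t
        by_cases htz : t = z
        · subst htz
          rcases Nat.eq_or_lt_of_le hbz with h1 | h1
          · subst h1
            rw [if_neg hbI] at a1
            rw [if_neg hzJ] at a2
            omega
          · rw [if_pos (hzI h1)] at a1
            rw [if_neg hzJ] at a2
            split_ifs at * <;> omega
        · have := gap t t1 t2 (by grind) (by grind) (by grind) (by grind)
          split_ifs at * <;> omega
    refine ⟨z, _, P, M.erase b, (insert b I).erase z, J, hD, ?_, hbz, hzn, ?_, hz, hmin, ?_⟩
    · rw [hD.Phi_eq, ← sort_erase]
      congr 1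
      apply enc_erase_hi hb1 hbn <;> grind
    · grind
    · apply enc_erase_hi (by omega) hzn <;> grind
  · have hlt : b < z := by
      rcases Nat.eq_or_lt_of_le hbz with h1 | h1
      · exact absurd (h1 ▸ hb) hzJ
      · exact h1
    have hzm := hzI hlt
    have cI := fun y => cge_erase hzm y
    have cJ := fun y => cge_erase hb y
    have hD : Dec n ((enc n (insert b P ∪ I.erase z) (M ∪ I.erase z)).sort
        (· ≤ ·)) (insert b P) M (I.erase z) (J.erase b) := by
      constructor
      · grind
      · grind
      · grind
      · grind
      · grind
      · grind
      · grind
      · grind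
      · grind
      · grind
      · rfl
      · intro y
        have := cJ y
        have := cI y
        have := nonneg y
        have := hmin' y
        split_ifs at * <;> omega
      · rw [Finset.card_erase_of_mem hb, Finset.card_erase_of_mem hzm, bal]
      · intro t t1 t2 t3 t4 t5 t6
        have := cJ t
        have := cI t
        have := hmin' t
        by_cases htz : t = z
        · subst htz
          rw [if_pos hzm] at a1
          rw [if_neg hzJ] at a2
          split_ifs at * <;> omega
        · have := gap t t1 t2 (by grind) (by grind) (by grind) (by grind)
          split_ifs at * <;> omega
    refine ⟨z, _, insert b P, M, I.erase z, J.erase b, hD, ?_, hbz, hzn, ?_, hz, hmin, ?_⟩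
    · rw [hD.Phi_eq, ← sort_erase]
      congr 1
      apply enc_erase_hi hb1 hbn <;> grind
    · grind
    · apply enc_erase_hi (by omega) hzn <;> grind

/-- deletion lemma for the left key: after the jeu de taquin slides the
entry `β` of `rC₁` (in row `p`) out of the first column, the left split column `ℓC₁'` of
the resulting column loses exactly one entry, namely the first entry of `ℓC₁`, scanning
upwards from row `p`, bigger than the entry directly Northeast of it, or the top entry
of `ℓC₁` if no such entry exists. -/
theorem left_key_deletion (n : ℕ) (C1 C2 : List ℕ)
    (h1 : IsColumn n C1) (h1a : OCC n C1) (h2 : IsColumn n C2) (h2a : OCC n C2)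
    (hlen : C2.length < C1.length)
    (hrow : ∀ i < C2.length, (rCol n C1).getD i 0 ≤ (lCol n C2).getD i 0)
    (p : ℕ) (hp : FirstHSlideRow n C1 C2 p)
    (β : ℕ) (hβ : β = (rCol n C1).getD (p - 1) 0)
    (C1' : List ℕ)
    (hC1' : C1' = if n < β then PhiInvF n ((PhiCol n C1).erase β) else C1.erase β) :
    ∃ q, 1 ≤ q ∧ q ≤ p ∧
      (∀ q', q < q' → q' ≤ p →
        (lCol n C1).getD (q' - 1) 0 ≤ (rCol n C1).getD (q' - 2) 0) ∧
      (2 ≤ q → (rCol n C1).getD (q - 2) 0 < (lCol n C1).getD (q - 1) 0) ∧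
      lCol n C1' = (lCol n C1).eraseIdx (q - 1) := by
  obtain ⟨P, M, I, J, h⟩ := dec_exists h1 h1a
  obtain ⟨hp1, hp2, _, _⟩ := hp
  have hdel := h.delta
  have hle : ∀ y, clt (enc n (P ∪ I) (M ∪ J)) y ≤ clt (enc n (P ∪ J) (M ∪ I)) y := by
    intro y
    have := hdel y
    have := h.nonneg (if y ≤ n + 1 then y else 2 * n + 2 - y)
    omega
  have cardlt : ∀ A B, clt (enc n A B) (2 * n + 1) = (enc n A B).card := by
    intro A B
    have := clt_add_cge (enc n A B) (2 * n + 1)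
    have := cge_top (n := 2 * n) (S := enc n A B) (fun x hx => (enc_bd x hx).2)
    omega
  have hcard1 : C1.length = (enc n (P ∪ I) (M ∪ I)).card := by
    rw [h.hC, Finset.length_sort]
  have cc : ∀ A B : Finset ℕ, (∀ x ∈ A, 1 ≤ x ∧ x ≤ n) → (∀ x ∈ B, 1 ≤ x ∧ x ≤ n) →
      (enc n A B).card = A.card + B.card := by
    intro A B hA hB
    have e : enc n A B = A ∪ B.image (bar n) := by
      symm
      apply enc_ext
      · intro x hx
        rw [Finset.mem_union, Finset.mem_image] at hx
        rcases hx with hx | ⟨y, hy, rfl⟩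
        · have := hA x hx; omega
        · have := hB y hy; unfold bar; omega
      · intro y a b
        rw [Finset.mem_union, Finset.mem_image]
        constructor
        · rintro (hx | ⟨w, hw, rfl⟩)
          · exact hx
          · have := hB w hw; unfold bar at b; omega
        · exact Or.inl
      · intro y a b
        rw [Finset.mem_union, Finset.mem_image]
        constructor
        · rintro (hx | ⟨w, hw, hw'⟩)
          · have := hA _ hx; unfold bar at this; omega
          · have := hB w hw
            have : w = y := by unfold bar at hw'; omega
            exact this ▸ hw
        · intro hy; exact Or.inr ⟨y, hy, rfl⟩
    rw [e, Finset.card_union_of_disjoint, Finset.card_image_of_injOn]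
    · intro x hx y hy hxy
      have := hB x hx
      have := hB y hy
      simp only [bar] at hxy; omega
    · rw [Finset.disjoint_left]
      intro x hx hx'
      obtain ⟨y, hy, rfl⟩ := Finset.mem_image.1 hx'
      have := hA _ hx
      have := hB y hy
      unfold bar at *; omega
  have cu : ∀ A B : Finset ℕ, (∀ x ∈ A, x ∉ B) → (A ∪ B).card = A.card + B.card := by
    intro A B hAB
    exact Finset.card_union_of_disjoint (Finset.disjoint_left.2 (fun x => hAB x))
  have bu : ∀ A B : Finset ℕ, (∀ x ∈ A, 1 ≤ x ∧ x ≤ n) → (∀ x ∈ B, 1 ≤ x ∧ x ≤ n) →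
      ∀ x ∈ A ∪ B, 1 ≤ x ∧ x ≤ n := by
    intro A B hA hB x hx
    rcases Finset.mem_union.1 hx with hx | hx
    · exact hA x hx
    · exact hB x hx
  rw [cc _ _ (bu _ _ h.bP h.bI) (bu _ _ h.bM h.bI), cu _ _ h.PI, cu _ _ h.MI] at hcard1
  have hcR : (enc n (P ∪ I) (M ∪ J)).card = C1.length := by
    rw [cc _ _ (bu _ _ h.bP h.bI) (bu _ _ h.bM h.bJ), cu _ _ h.PI, cu _ _ h.MJ, ← h.bal, hcard1]
  have hcL : (enc n (P ∪ J) (M ∪ I)).card = C1.length := by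
    rw [cc _ _ (bu _ _ h.bP h.bJ) (bu _ _ h.bM h.bI), cu _ _ h.PJ, cu _ _ h.MI, ← h.bal, hcard1]
  rw [h.rCol_eq] at hβ
  rw [h.lCol_eq, h.rCol_eq]
  have hβR : β ∈ enc n (P ∪ I) (M ∪ J) := by
    rw [hβ]; exact (clt_getElem _ _ (by omega)).1
  have hβbd := enc_bd β hβR
  by_cases hn : n < β
  · rw [if_pos hn] at hC1'
    have hbb : bar n (bar n β) = β := bar_bar (by omega)
    have hb1 : 1 ≤ bar n β := by unfold bar; omega
    have hb2 : bar n β ≤ n := by unfold bar; omega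
    have hbm : bar n β ∈ M ∨ bar n β ∈ J := by
      rw [← hbb, mem_enc_hi hb1 hb2, Finset.mem_union] at hβR
      exact hβR
    obtain ⟨z, C', P', M', I', J', h', hPhi, hbz, hzn, hzm, hz, hmin, hL⟩ := caseB h hb1 hb2 hbm
    rw [hbb] at hPhi
    rw [h'.PhiInv hPhi] at hC1'
    subst hC1'
    rw [h'.lCol_eq, hL]
    have hwu : ∀ u, 1 ≤ u → u ≤ n →
        (if bar n u ≤ n + 1 then bar n u else 2 * n + 2 - bar n u) = u + 1 := by
      intro u a b; unfold bar; split_ifs <;> omega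
    refine rows (by omega) hle hp1 (by omega) hβ ?_ ?_ ?_ ?_
    · rw [mem_enc_hi (by omega) hzn]; exact hzm
    · unfold bar at *; omega
    · have := hdel (bar n z)
      rw [hwu z (by omega) hzn] at this
      omega
    · intro y hy y1 y2
      have hyb := enc_bd y hy
      have e : y = bar n (bar n y) := (bar_bar (by omega)).symm
      have k1 : bar n β ≤ bar n y := by unfold bar; omega
      have k2 : bar n y < z := by unfold bar at *; omega
      have := hdel y
      have k3 := hmin (bar n y) k1 k2
      have k4 := hwu (bar n y) (by omega) (by omega)
      rw [← e] at k4
      rw [k4] at this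
      omega
  · rw [if_neg hn] at hC1'
    have hbm : β ∈ P ∨ β ∈ I := by
      rw [mem_enc_lo (by omega) (by omega), Finset.mem_union] at hβR
      exact hβR
    obtain ⟨x, P', M', I', J', h', hx1, hxβ, hxm, hx, hmax, hL⟩ :=
      caseA h hβbd.1 (by omega) hbm
    rw [← hC1'] at h'
    rw [h'.lCol_eq, hL]
    refine rows (by omega) hle hp1 (by omega) hβ ?_ hxβ ?_ ?_
    · rw [mem_enc_lo (by omega) (by omega)]; exact hxm
    · have := hdel x
      rw [if_pos (by omega)] at this
      omega
    · intro y hy y1 y2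
      have := hdel y
      rw [if_pos (by omega)] at this
      have := hmax y y1 y2
      omega
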